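/- Let R > 0, p > 4, α = 1 − 4/p, let G̃ = G + ψ with G the standard Gaussian and ψ ∈ W^{2,1}(ℝ²), let J ∈ C⁰(ℝ²) and ε = ‖J − 1‖_{L^∞(B_{2R})}, and let 0 < s ≤ 1. For measurable u: ℝ² → [0,1] vanishing outside B_R, define 𝒫_{J,s}(u)(x) = ∬ u(ξ) G̃_s(x−ξ) J(ξ−η) G̃_s(x−η) u(η) dξ dη. Then there exists a constant C depending on p only such that for every such u: ‖𝒫_{J,s}(u)‖_{C^{0,α}(ℝ²)} ≤ ((1+ε)C/s) ‖G̃‖²_{W^{1,1}(ℝ²)} ‖u‖_{L¹(B_R)}^{2/p}, and ‖∇𝒫_{J,s}(u)‖_{C^{0,α}(ℝ²)} ≤ ((1+ε)C/s²) ‖G̃‖²_{W^{2,1}(ℝ²)} ‖u‖_{L¹(B_R)}^{2/p}. -/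

import Mathlib

open MeasureTheory Metric Set

noncomputable section

abbrev E2 : Type := EuclideanSpace ℝ (Fin 2)

/-- The standard Gaussian on the plane, `G x = (2π)⁻¹ exp (-|x|²/2)`. -/
def Gauss : E2 → ℝ := fun x => (2 * Real.pi)⁻¹ * Real.exp (-‖x‖ ^ 2 / 2)

/-- `g` is the weak partial derivative of `f` in the direction of the `i`-th coordinate. -/
def IsWeakPartialDeriv (i : Fin 2) (f g : E2 → ℝ) : Prop :=
  ∀ φ : E2 → ℝ, ContDiff ℝ (⊤ : ℕ∞) φ → HasCompactSupport φ →
    ∫ x, f x * fderiv ℝ φ x (EuclideanSpace.single i 1) = -∫ x, g x * φ x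

/-- The Hopkins-type bilinear intensity operator
`𝒫(u)(x) = ∬ u ξ Gs (x-ξ) J (ξ-η) Gs (x-η) u η dξ dη`. -/
def Pop (Gs J u : E2 → ℝ) (x : E2) : ℝ :=
  ∫ ξ, ∫ η, u ξ * Gs (x - ξ) * J (ξ - η) * Gs (x - η) * u η

/-- Rescaling `f_s (x) = s⁻² f (x / s)`. -/
def resc (s : ℝ) (f : E2 → ℝ) : E2 → ℝ := fun x => (s⁻¹) ^ 2 * f (s⁻¹ • x)

/-- First classical partial derivatives of the Gaussian. -/
def GaussD (i : Fin 2) (x : E2) : ℝ := fderiv ℝ Gauss x (EuclideanSpace.single i 1)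

/-- Second classical partial derivatives of the Gaussian. -/
def GaussD2 (i j : Fin 2) (x : E2) : ℝ :=
  fderiv ℝ (GaussD i) x (EuclideanSpace.single j 1)


/-- Weak derivative in the direction `v`. -/
def IsWD (v : E2) (f g : E2 → ℝ) : Prop :=
  ∀ φ : E2 → ℝ, ContDiff ℝ (⊤ : ℕ∞) φ → HasCompactSupport φ →
    ∫ x, f x * fderiv ℝ φ x v = -∫ x, g x * φ x

lemma shear_mp (μ : Measure ℝ) [SFinite μ] (v : E2) :
    MeasurePreserving (fun z : ℝ × E2 => (z.1, z.2 + z.1 • v)) (μ.prod volume)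
      (μ.prod volume) := by
  refine MeasurePreserving.skew_product (f := id) (g := fun t y => y + t • v)
    (MeasurePreserving.id μ) ?_ ?_
  · unfold Function.uncurry; fun_prop
  · exact Filter.Eventually.of_forall fun t => (measurePreserving_add_right volume (t • v)).map_eq

lemma shear_integrable {g : E2 → ℝ} (hg : Integrable g) (v : E2) (T : ℝ) :
    Integrable (fun z : ℝ × E2 => g (z.2 + z.1 • v))
      ((volume.restrict (Ioc 0 T)).prod volume) := by
  have h : Integrable (fun z : ℝ × E2 => g z.2) ((volume.restrict (Ioc 0 T)).prod volume) :=
    hg.comp_snd _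
  exact (shear_mp _ v).integrable_comp_of_integrable h

lemma shear_aesm {g : E2 → ℝ} (hg : AEStronglyMeasurable g) (v : E2) (μ : Measure ℝ) [SFinite μ] :
    AEStronglyMeasurable (fun z : ℝ × E2 => g (z.2 + z.1 • v)) (μ.prod volume) := by
  have h : AEStronglyMeasurable (fun z : ℝ × E2 => g z.2) (μ.prod volume) := hg.comp_snd
  exact h.comp_measurePreserving (shear_mp _ v)

lemma test_bdd {φ : E2 → ℝ} (h1 : Continuous φ) (h2 : HasCompactSupport φ) :
    ∃ c, ∀ x, ‖φ x‖ ≤ c := h2.exists_bound_of_continuous h1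

lemma ftc_ae {f g : E2 → ℝ} {v : E2} (hf : Integrable f) (hg : Integrable g)
    (h : IsWD v f g) {T : ℝ} (hT : 0 ≤ T) :
    ∀ᵐ y, f (y + T • v) - f y = ∫ t in Ioc 0 T, g (y + t • v) := by
  have hsh := shear_integrable hg v T
  have hI : Integrable (fun y => ∫ t in Ioc 0 T, g (y + t • v)) := hsh.integral_prod_right
  refine ae_eq_of_integral_contDiff_smul_eq ((hf.comp_add_right _).sub hf).locallyIntegrable
    hI.locallyIntegrable ?_
  intro φ hφ hc
  obtain ⟨c, hcb⟩ := test_bdd hφ.continuous hc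
  have hφ1 : ContDiff ℝ 1 φ := hφ.of_le (by exact_mod_cast le_top)
  have hdc : Continuous (fun x => fderiv ℝ φ x v) :=
    (hφ1.continuous_fderiv one_ne_zero).clm_apply continuous_const
  obtain ⟨d, hdb⟩ := test_bdd hdc (hc.fderiv_apply (𝕜 := ℝ) v)
  simp only [smul_eq_mul]
  have e1 : ∫ x, φ x * (f (x + T • v) - f x) = ∫ x, f x * (φ (x - T • v) - φ x) := by
    have i1 : Integrable (fun x => φ x * f (x + T • v)) :=
      (hf.comp_add_right _).bdd_mul hφ.continuous.aestronglyMeasurable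
        (Filter.Eventually.of_forall hcb)
    have i2 : Integrable (fun x => φ x * f x) :=
      hf.bdd_mul hφ.continuous.aestronglyMeasurable (Filter.Eventually.of_forall hcb)
    have i3 : Integrable (fun x => φ (x - T • v) * f x) :=
      hf.bdd_mul (hφ.continuous.comp (by fun_prop)).aestronglyMeasurable
        (Filter.Eventually.of_forall fun x => hcb _)
    have : ∫ x, φ x * f (x + T • v) = ∫ x, φ (x - T • v) * f x := by
      rw [← integral_add_right_eq_self (fun x => φ (x - T • v) * f x) (T • v)]
      simp
    simp only [mul_sub]
    rw [integral_sub i1 i2, this, ← integral_sub i3 i2]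
    congr 1; ext x; ring
  have e2 : ∀ x, φ (x - T • v) - φ x = - ∫ t in Ioc 0 T, fderiv ℝ φ (x - t • v) v := by
    intro x
    have hd : ∀ t ∈ uIcc 0 T, HasDerivAt (fun t : ℝ => φ (x - t • v))
        (- fderiv ℝ φ (x - t • v) v) t := by
      intro t _
      have h1 : HasFDerivAt φ (fderiv ℝ φ (x - t • v)) (x - t • v) :=
        (hφ1.differentiable one_ne_zero _).hasFDerivAt
      have h2 : HasDerivAt (fun t : ℝ => x - t • v) (-v) t := by
        have := ((hasDerivAt_id t).smul_const v).const_sub x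
        simpa using this
      have := h1.comp_hasDerivAt t h2
      rw [map_neg] at this
      exact this
    have := intervalIntegral.integral_eq_sub_of_hasDerivAt hd
      (Continuous.intervalIntegrable (by
        exact (hdc.comp (by fun_prop : Continuous fun t : ℝ => x - t • v)).neg) _ _)
    rw [intervalIntegral.integral_neg, intervalIntegral.integral_of_le hT] at this
    simp at this
    linarith
  rw [e1]
  simp_rw [e2]
  have e3 : ∫ x, f x * -∫ t in Ioc 0 T, fderiv ℝ φ (x - t • v) v
      = - ∫ x, ∫ t in Ioc 0 T, f x * fderiv ℝ φ (x - t • v) v := by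
    rw [← integral_neg]; congr 1; ext x
    rw [integral_const_mul]; ring
  rw [e3, integral_integral_swap]
  · have e4 : ∀ t : ℝ, ∫ x, f x * fderiv ℝ φ (x - t • v) v = - ∫ x, φ x * g (x + t • v) := by
      intro t
      have := h (fun x => φ (x - t • v)) (hφ.comp (contDiff_id.sub contDiff_const))
        (hc.comp_homeomorph (Homeomorph.subRight (t • v)))
      have hfd : ∀ x, fderiv ℝ (fun x => φ (x - t • v)) x = fderiv ℝ φ (x - t • v) := by
        intro x
        exact fderiv_comp_sub (t • v)
      simp only [hfd] at this
      rw [this, ← integral_add_right_eq_self (fun x => g x * φ (x - t • v)) (t • v)]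
      simp [mul_comm]
    simp_rw [e4]
    rw [integral_neg, neg_neg, integral_integral_swap]
    · simp_rw [integral_const_mul]
    · refine hsh.bdd_mul (c := c) ?_ (Filter.Eventually.of_forall fun z => hcb _)
      exact (hφ.continuous.comp continuous_snd).aestronglyMeasurable
  · have hfs : Integrable (fun z : E2 × ℝ => f z.1)
        (volume.prod (volume.restrict (Ioc 0 T))) := hf.comp_fst _
    refine (hfs.bdd_mul (c := d) (f := fun z => fderiv ℝ φ (z.1 - z.2 • v) v) ?_
      (Filter.Eventually.of_forall fun z => hdb _)).congr
      (Filter.Eventually.of_forall fun z => mul_comm _ _)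
    exact (hdc.comp (by fun_prop : Continuous fun z : E2 × ℝ => z.1 - z.2 • v)).aestronglyMeasurable

lemma transl_L1 {f g : E2 → ℝ} {v : E2} (hf : Integrable f) (hg : Integrable g)
    (h : IsWD v f g) {T : ℝ} (hT : 0 ≤ T) :
    ∫⁻ y, ‖f (y + T • v) - f y‖ₑ ≤ ENNReal.ofReal T * ∫⁻ y, ‖g y‖ₑ := by
  calc ∫⁻ y, ‖f (y + T • v) - f y‖ₑ
      = ∫⁻ y, ‖∫ t in Ioc 0 T, g (y + t • v)‖ₑ := by
        refine lintegral_congr_ae ?_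
        filter_upwards [ftc_ae hf hg h hT] with y hy
        rw [hy]
    _ ≤ ∫⁻ y, ∫⁻ t in Ioc 0 T, ‖g (y + t • v)‖ₑ :=
        lintegral_mono fun y => enorm_integral_le_lintegral_enorm _
    _ = ∫⁻ t in Ioc 0 T, ∫⁻ y, ‖g (y + t • v)‖ₑ := by
        rw [lintegral_lintegral_swap]
        exact (shear_aesm hg.1 v _).enorm.prod_swap
    _ = ∫⁻ t in Ioc 0 T, ∫⁻ y, ‖g y‖ₑ := by
        congr 1; ext t
        exact lintegral_add_right_eq_self (fun y => ‖g y‖ₑ) (t • v)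
    _ = ENNReal.ofReal T * ∫⁻ y, ‖g y‖ₑ := by
        simp [mul_comm]

lemma remainder_L1 {f g k : E2 → ℝ} {v : E2} (hf : Integrable f) (hg : Integrable g)
    (hk : Integrable k) (h : IsWD v f g) (h' : IsWD v g k) :
    ∫⁻ y, ‖f (y + v) - f y - g y‖ₑ ≤ ∫⁻ y, ‖k y‖ₑ := by
  have hsh := shear_integrable hg v 1
  calc ∫⁻ y, ‖f (y + v) - f y - g y‖ₑ
      = ∫⁻ y, ‖∫ t in Ioc (0:ℝ) 1, (g (y + t • v) - g y)‖ₑ := by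
        refine lintegral_congr_ae ?_
        filter_upwards [ftc_ae hf hg h zero_le_one, hsh.prod_left_ae] with y hy hy2
        rw [integral_sub hy2 (integrable_const _), ← hy]
        simp
    _ ≤ ∫⁻ y, ∫⁻ t in Ioc (0:ℝ) 1, ‖g (y + t • v) - g y‖ₑ :=
        lintegral_mono fun y => enorm_integral_le_lintegral_enorm _
    _ = ∫⁻ t in Ioc (0:ℝ) 1, ∫⁻ y, ‖g (y + t • v) - g y‖ₑ := by
        rw [lintegral_lintegral_swap]
        exact ((shear_aesm hg.1 v _).sub hg.1.comp_snd).enorm.prod_swap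
    _ ≤ ∫⁻ t in Ioc (0:ℝ) 1, ∫⁻ y, ‖k y‖ₑ := by
        refine setLIntegral_mono' measurableSet_Ioc fun t ht => ?_
        refine (transl_L1 hg hk h' ht.1.le).trans ?_
        calc _ ≤ ENNReal.ofReal 1 * ∫⁻ y, ‖k y‖ₑ := by
              gcongr; exact ht.2
          _ = _ := by simp
    _ = ∫⁻ y, ‖k y‖ₑ := by simp

lemma line_bound {f g : E2 → ℝ} {v : E2} (hv : v ≠ 0) (hf : Integrable f) (hg : Integrable g)
    (h : IsWD v f g) : ∀ᵐ y, ‖f y‖ₑ ≤ ∫⁻ t : ℝ, ‖g (y + t • v)‖ₑ := by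
  set Gf : E2 → ENNReal := fun y => ∫⁻ t : ℝ, ‖g (y + t • v)‖ₑ with hGf
  have hGm : AEMeasurable Gf := by
    exact (shear_aesm hg.1 v volume).enorm.lintegral_prod_left'
  have key : ∀ n : ℕ, ∀ᵐ y, ‖f y‖ₑ - Gf y ≤ ‖f (y + (n : ℝ) • v)‖ₑ := by
    intro n
    filter_upwards [ftc_ae hf hg h (Nat.cast_nonneg n)] with y hy
    rw [tsub_le_iff_right]
    have : f y = f (y + (n : ℝ) • v) - ∫ t in Ioc (0:ℝ) n, g (y + t • v) := by rw [← hy]; ring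
    rw [this]
    refine enorm_sub_le.trans ?_
    gcongr
    exact (enorm_integral_le_lintegral_enorm _).trans (setLIntegral_le_lintegral _ _)
  have hball : ∀ m : ℕ, ∫⁻ y in ball (0 : E2) m, (‖f y‖ₑ - Gf y) = 0 := by
    intro m
    have hle : ∀ n : ℕ, ∫⁻ y in ball (0 : E2) m, (‖f y‖ₑ - Gf y) ≤
        ∫⁻ z, (ball ((n : ℝ) • v) m).indicator (fun z => ‖f z‖ₑ) z := by
      intro n
      calc _ ≤ ∫⁻ y in ball (0 : E2) m, ‖f (y + (n : ℝ) • v)‖ₑ :=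
            lintegral_mono_ae (ae_restrict_of_ae (key n))
        _ = ∫⁻ y, (ball ((n : ℝ) • v) (m : ℝ)).indicator (fun z => ‖f z‖ₑ) (y + (n : ℝ) • v) := by
            rw [← lintegral_indicator measurableSet_ball]
            congr 1; ext y
            simp [indicator, mem_ball, dist_eq_norm]
        _ = _ := lintegral_add_right_eq_self _ _
    have hlim : Filter.Tendsto (fun n : ℕ =>
        ∫⁻ z, (ball ((n : ℝ) • v) m).indicator (fun z => ‖f z‖ₑ) z) Filter.atTop
        (nhds (∫⁻ _ : E2, 0)) := by
      refine tendsto_lintegral_of_dominated_convergence' (fun z => ‖f z‖ₑ) ?_ ?_ ?_ ?_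
      · intro n; exact hf.1.enorm.indicator measurableSet_ball
      · intro n; exact Filter.Eventually.of_forall fun z => indicator_le_self _ _ _
      · exact hf.2.ne
      · refine Filter.Eventually.of_forall fun z => ?_
        refine tendsto_const_nhds.congr' ?_
        have hv' : 0 < ‖v‖ := norm_pos_iff.2 hv
        filter_upwards [Filter.eventually_ge_atTop ⌈(m + ‖z‖) / ‖v‖⌉₊] with n hn
        symm
        refine indicator_of_notMem ?_ _
        rw [mem_ball, dist_eq_norm, not_lt]
        have h1 : (m + ‖z‖) / ‖v‖ ≤ n := (Nat.le_ceil _).trans (by exact_mod_cast hn)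
        rw [div_le_iff₀ hv'] at h1
        have h2 : ‖(n : ℝ) • v‖ = n * ‖v‖ := by rw [norm_smul]; simp
        have h3 := norm_sub_norm_le ((n : ℝ) • v) z
        rw [norm_sub_rev] at h3
        linarith
    simp only [lintegral_zero] at hlim
    exact le_antisymm (ge_of_tendsto' hlim hle) bot_le
  have hz : ∀ m : ℕ, ∀ᵐ y, y ∈ ball (0 : E2) m → ‖f y‖ₑ ≤ Gf y := by
    intro m
    have := hball m
    have := (lintegral_eq_zero_iff' ((hf.1.enorm.sub hGm).restrict)).1 this
    have := (ae_restrict_iff' measurableSet_ball).1 this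
    filter_upwards [this] with y hy hym
    have := hy hym
    simpa [tsub_eq_zero_iff_le] using this
  filter_upwards [ae_all_iff.2 hz] with y hy
  obtain ⟨m, hm⟩ := exists_nat_gt ‖y‖
  exact hy m (by simpa using hm)

lemma IsWD.congr {v : E2} {f f' g g' : E2 → ℝ} (h : IsWD v f g) (hf : f =ᵐ[volume] f')
    (hg : g =ᵐ[volume] g') : IsWD v f' g' := by
  intro φ h1 h2
  have := h φ h1 h2
  have e1 : ∫ x, f x * fderiv ℝ φ x v = ∫ x, f' x * fderiv ℝ φ x v := by
    refine integral_congr_ae ?_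
    filter_upwards [hf] with x hx; rw [hx]
  have e2 : ∫ x, g x * φ x = ∫ x, g' x * φ x := by
    refine integral_congr_ae ?_
    filter_upwards [hg] with x hx; rw [hx]
  rw [← e1, ← e2, this]

lemma sobolev_meas {f : E2 → ℝ} {g : Fin 2 → E2 → ℝ} (hf : Integrable f)
    (hg : ∀ i, Integrable (g i)) (hgm : ∀ i, Measurable (g i))
    (h : ∀ i, IsWD (EuclideanSpace.single i 1) f (g i)) :
    ∫⁻ y, ‖f y‖ₑ ^ (2 : ℝ) ≤ (∑ i, ∫⁻ y, ‖g i y‖ₑ) ^ (2 : ℝ) := by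
  set H : E2 → ENNReal := fun y => ∑ i, ‖g i y‖ₑ with hH
  have hHm : Measurable H := by
    refine Finset.measurable_sum _ fun i _ => (hgm i).enorm
  have hmp := PiLp.volume_preserving_toLp (Fin 2)
  have hemb : MeasurableEmbedding (WithLp.toLp 2 : (Fin 2 → ℝ) → E2) :=
    (MeasurableEquiv.toLp 2 (Fin 2 → ℝ)).measurableEmbedding
  have hl : ∀ i : Fin 2, ∀ᵐ y, ‖f y‖ₑ ≤ ∫⁻ t : ℝ, H (y + t • EuclideanSpace.single i 1) := by
    intro i
    filter_upwards [line_bound (by simp) hf (hg i) (h i)] with y hy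
    refine hy.trans (lintegral_mono fun t => ?_)
    exact Finset.single_le_sum (f := fun i => ‖g i (y + t • _)‖ₑ) (fun _ _ => bot_le)
      (Finset.mem_univ i)
  have hupd : ∀ (i : Fin 2) (x : Fin 2 → ℝ),
      ∫⁻ t : ℝ, H (WithLp.toLp 2 x + t • EuclideanSpace.single i 1) =
      ∫⁻ t : ℝ, H (WithLp.toLp 2 (Function.update x i t)) := by
    intro i x
    rw [← lintegral_add_left_eq_self
      (fun t : ℝ => H (WithLp.toLp 2 (Function.update x i t))) (x i)]
    congr 1; ext t; congr 1; ext j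
    by_cases hj : j = i
    · subst hj; simp
    · simp [hj]
  calc ∫⁻ y, ‖f y‖ₑ ^ (2 : ℝ)
      ≤ ∫⁻ y : E2, ∏ i : Fin 2, ∫⁻ t : ℝ, H (y + t • EuclideanSpace.single i 1) := by
        refine lintegral_mono_ae ?_
        filter_upwards [hl 0, hl 1] with y h0 h1
        rw [Fin.prod_univ_two, ENNReal.rpow_two, sq]
        gcongr
    _ = ∫⁻ x : Fin 2 → ℝ, ∏ i : Fin 2, ∫⁻ t : ℝ, H (WithLp.toLp 2 (Function.update x i t)) := by
        rw [← hmp.lintegral_comp_emb hemb]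
        simp_rw [hupd]
    _ ≤ (∫⁻ x : Fin 2 → ℝ, H (WithLp.toLp 2 x)) ^ (2 : ℝ) := by
        have := lintegral_prod_lintegral_pow_le (ι := Fin 2) (fun _ : Fin 2 => (volume : Measure ℝ))
          (p := 2) (by constructor <;> norm_num)
          (f := fun x => H (WithLp.toLp 2 x)) (hHm.comp hemb.measurable)
        norm_num at this
        simpa [volume_pi] using this
    _ = (∑ i, ∫⁻ y, ‖g i y‖ₑ) ^ (2 : ℝ) := by
        rw [hmp.lintegral_comp_emb hemb, hH, lintegral_finsetSum _ fun i _ => (hgm i).enorm]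

lemma sobolev {f : E2 → ℝ} {g : Fin 2 → E2 → ℝ} (hf : Integrable f)
    (hg : ∀ i, Integrable (g i))
    (h : ∀ i, IsWD (EuclideanSpace.single i 1) f (g i)) :
    ∫⁻ y, ‖f y‖ₑ ^ (2 : ℝ) ≤ (∑ i, ∫⁻ y, ‖g i y‖ₑ) ^ (2 : ℝ) := by
  have hgm : ∀ i, ∃ g' : E2 → ℝ, Measurable g' ∧ g i =ᵐ[volume] g' := fun i => (hg i).1.aemeasurable
  choose g' hm he using hgm
  have := sobolev_meas (g := g') hf (fun i => (hg i).congr (he i)) hm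
    (fun i => (h i).congr (Filter.EventuallyEq.refl _ _) (he i))
  refine this.trans (le_of_eq ?_)
  congr 2; ext i
  refine lintegral_congr_ae ?_
  filter_upwards [he i] with y hy
  rw [hy]

/-- `f` is in `W^{1,1}` with weak partial derivatives `g`. -/
structure W1 (f : E2 → ℝ) (g : Fin 2 → E2 → ℝ) : Prop where
  int : Integrable f
  dint : ∀ i, Integrable (g i)
  wd : ∀ i, IsWeakPartialDeriv i f (g i)

lemma lintegral_enorm_real {f : E2 → ℝ} (hf : Integrable f) :
    ∫⁻ y, ‖f y‖ₑ = ENNReal.ofReal (∫ y, |f y|) :=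
  (ofReal_integral_norm_eq_lintegral_enorm hf).symm

lemma int_abs_nonneg (f : E2 → ℝ) : 0 ≤ ∫ y, |f y| := integral_nonneg fun _ => abs_nonneg _

lemma test_int {f φ : E2 → ℝ} (hf : Integrable f) (h1 : Continuous φ) (h2 : HasCompactSupport φ) :
    Integrable (fun x => f x * φ x) := by
  obtain ⟨c, hc⟩ := test_bdd h1 h2
  exact hf.mul_bdd (c := c) h1.aestronglyMeasurable (Filter.Eventually.of_forall hc)

lemma W1.isWD {f : E2 → ℝ} {g : Fin 2 → E2 → ℝ} (h : W1 f g) (v : E2) :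
    IsWD v f (fun y => ∑ i, v i * g i y) := by
  intro φ h1 h2
  have hv : v = ∑ i, v i • EuclideanSpace.single i (1 : ℝ) := by
    ext j; fin_cases j <;> simp
  have hφ1 : ContDiff ℝ 1 φ := h1.of_le (by exact_mod_cast le_top)
  have hdc : ∀ w : E2, Continuous (fun x => fderiv ℝ φ x w) := fun w =>
    (hφ1.continuous_fderiv one_ne_zero).clm_apply continuous_const
  have e : ∀ x, fderiv ℝ φ x v = ∑ i, v i * fderiv ℝ φ x (EuclideanSpace.single i 1) := by
    intro x
    conv_lhs => rw [hv]
    simp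
  simp_rw [e, Finset.mul_sum, Finset.sum_mul]
  rw [integral_finsetSum, integral_finsetSum, ← Finset.sum_neg_distrib]
  · refine Finset.sum_congr rfl fun i _ => ?_
    simp_rw [mul_left_comm _ (v i), mul_assoc (v i)]
    rw [integral_const_mul, integral_const_mul, h.wd i φ h1 h2, mul_neg]
  · intro i _
    simp_rw [mul_assoc (v i)]
    exact (test_int (h.dint i) h1.continuous h2).const_mul _
  · intro i _
    simp_rw [mul_left_comm _ (v i)]
    exact (test_int h.int (hdc _) (h2.fderiv_apply (𝕜 := ℝ) _)).const_mul _

lemma coord_le (v : E2) (i : Fin 2) : |v i| ≤ ‖v‖ := by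
  simpa using PiLp.norm_apply_le v i

lemma dir_int {v : E2} {g : Fin 2 → E2 → ℝ} (hg : ∀ i, Integrable (g i)) :
    Integrable (fun y => ∑ i, v i * g i y) :=
  integrable_finsetSum _ fun i _ => (hg i).const_mul _

lemma dir_abs {v : E2} {g : Fin 2 → E2 → ℝ} (hg : ∀ i, Integrable (g i)) :
    ∫ y, |∑ i, v i * g i y| ≤ ‖v‖ * ∑ i, ∫ y, |g i y| := by
  calc ∫ y, |∑ i, v i * g i y| ≤ ∫ y, ∑ i, ‖v‖ * |g i y| := by
        refine integral_mono (dir_int hg).abs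
          (integrable_finsetSum _ fun i _ => (hg i).abs.const_mul _) fun y => ?_
        refine (Finset.abs_sum_le_sum_abs _ _).trans (Finset.sum_le_sum fun i _ => ?_)
        rw [abs_mul]
        exact mul_le_mul_of_nonneg_right (coord_le v i) (abs_nonneg _)
    _ = _ := by
        rw [integral_finsetSum _ fun i _ => (hg i).abs.const_mul _, Finset.mul_sum]
        simp_rw [integral_const_mul]

lemma W1.transl {f : E2 → ℝ} {g : Fin 2 → E2 → ℝ} (h : W1 f g) (v : E2) :
    ∫ y, |f (y + v) - f y| ≤ ‖v‖ * ∑ i, ∫ y, |g i y| := by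
  refine le_trans ?_ (dir_abs (v := v) h.dint)
  have h1 := transl_L1 h.int (dir_int h.dint) (h.isWD v) zero_le_one
  simp only [one_smul, ENNReal.ofReal_one, one_mul] at h1
  rw [lintegral_enorm_real (dir_int h.dint)] at h1
  have h2 := lintegral_enorm_real ((h.int.comp_add_right v).sub h.int)
  replace h1 := h2.symm.le.trans h1
  exact (ENNReal.ofReal_le_ofReal_iff (int_abs_nonneg _)).1 h1

lemma W1.remainder {f : E2 → ℝ} {g : Fin 2 → E2 → ℝ} {k : Fin 2 → Fin 2 → E2 → ℝ}
    (h : W1 f g) (h' : ∀ i, W1 (g i) (k i)) (v : E2) :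
    ∫ y, |f (y + v) - f y - ∑ i, v i * g i y| ≤ ‖v‖ ^ 2 * ∑ i, ∑ j, ∫ y, |k i j y| := by
  set K : Fin 2 → E2 → ℝ := fun j y => ∑ i, v i * k i j y with hK
  have hKi : ∀ j, Integrable (K j) := fun j => dir_int fun i => (h' i).dint j
  have hW : W1 (fun y => ∑ i, v i * g i y) K := by
    refine ⟨dir_int h.dint, hKi, fun j φ h1 h2 => ?_⟩
    have hφ1 : ContDiff ℝ 1 φ := h1.of_le (by exact_mod_cast le_top)
    have hdc : ∀ w : E2, Continuous (fun x => fderiv ℝ φ x w) := fun w =>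
      (hφ1.continuous_fderiv one_ne_zero).clm_apply continuous_const
    simp_rw [hK, Finset.sum_mul, mul_assoc (v _)]
    rw [integral_finsetSum, integral_finsetSum, ← Finset.sum_neg_distrib]
    · refine Finset.sum_congr rfl fun i _ => ?_
      rw [integral_const_mul, integral_const_mul, (h' i).wd j φ h1 h2, mul_neg]
    · intro i _
      exact (test_int ((h' i).dint j) h1.continuous h2).const_mul _
    · intro i _
      exact (test_int (h.dint i) (hdc _) (h2.fderiv_apply (𝕜 := ℝ) _)).const_mul _
  have h1 := remainder_L1 h.int (dir_int h.dint) (dir_int hKi) (h.isWD v) (hW.isWD v)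
  rw [lintegral_enorm_real (dir_int hKi)] at h1
  have h2 := lintegral_enorm_real
    (((h.int.comp_add_right v).sub h.int).sub (dir_int (v := v) h.dint))
  replace h1 := h2.symm.le.trans h1
  refine ((ENNReal.ofReal_le_ofReal_iff (int_abs_nonneg _)).1 h1).trans ?_
  refine (dir_abs hKi).trans ?_
  calc _ ≤ ‖v‖ * ∑ j, (‖v‖ * ∑ i, ∫ y, |k i j y|) := by
        gcongr with j
        exact dir_abs fun i => (h' i).dint j
    _ = _ := by
        rw [← Finset.mul_sum, Finset.sum_comm]; ring

lemma W1.sob {f : E2 → ℝ} {g : Fin 2 → E2 → ℝ} (h : W1 f g) :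
    ∫⁻ y, ‖f y‖ₑ ^ (2 : ℝ) ≤ (ENNReal.ofReal (∑ i, ∫ y, |g i y|)) ^ (2 : ℝ) := by
  have := sobolev h.int h.dint h.wd
  simp_rw [fun i => lintegral_enorm_real (h.dint i)] at this
  rwa [← ENNReal.ofReal_sum_of_nonneg fun i _ => int_abs_nonneg _] at this

lemma mul_u_int {F u : E2 → ℝ} (hF : Integrable F) (hum : Measurable u)
    (hu : ∀ x, u x ∈ Icc (0 : ℝ) 1) : Integrable (fun y => |F y| * u y) :=
  hF.abs.mul_bdd (c := 1) hum.aestronglyMeasurable (Filter.Eventually.of_forall fun x => by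
    rw [Real.norm_eq_abs, abs_of_nonneg (hu x).1]; exact (hu x).2)

lemma mul_u_le {F u : E2 → ℝ} (hF : Integrable F) (hum : Measurable u)
    (hu : ∀ x, u x ∈ Icc (0 : ℝ) 1) : ∫ y, |F y| * u y ≤ ∫ y, |F y| :=
  integral_mono (mul_u_int hF hum hu) hF.abs fun y =>
    mul_le_of_le_one_right (abs_nonneg _) (hu y).2

lemma mul_u_nonneg {F u : E2 → ℝ} 
    (hu : ∀ x, u x ∈ Icc (0 : ℝ) 1) : 0 ≤ ∫ y, |F y| * u y :=
  integral_nonneg fun y => mul_nonneg (abs_nonneg _) (hu y).1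

lemma interp {F u : E2 → ℝ} (hF : Integrable F) {M N : ℝ} (hM0 : 0 ≤ M)
    (hM : ∫⁻ y, ‖F y‖ₑ ^ (2 : ℝ) ≤ (ENNReal.ofReal M) ^ (2 : ℝ))
    (hN : ∫ y, |F y| ≤ N)
    (hum : Measurable u) (hu : ∀ x, u x ∈ Icc (0 : ℝ) 1) (hui : Integrable u)
    {θ : ℝ} (h0 : 0 ≤ θ) (h1 : θ ≤ 1) :
    ∫ y, |F y| * u y ≤ N ^ (1 - θ) * M ^ θ * (∫ y, u y) ^ (θ / 2) := by
  set A := ∫ y, |F y| * u y with hA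
  have hA0 : 0 ≤ A := mul_u_nonneg hu
  have hAN : A ≤ N := (mul_u_le hF hum hu).trans hN
  have hU0 : 0 ≤ ∫ y, u y := integral_nonneg fun y => (hu y).1
  have hAM : A ≤ M * (∫ y, u y) ^ (1 / 2 : ℝ) := by
    have e1 : ENNReal.ofReal A = ∫⁻ y, ‖F y‖ₑ * ENNReal.ofReal (u y) := by
      rw [hA, ofReal_integral_eq_lintegral_ofReal (mul_u_int hF hum hu)
        (Filter.Eventually.of_forall fun y => mul_nonneg (abs_nonneg _) (hu y).1)]
      congr 1; ext y
      rw [ENNReal.ofReal_mul (abs_nonneg _), ← Real.norm_eq_abs, ofReal_norm]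
    have e2 : ∫⁻ y, ENNReal.ofReal (u y) ^ (2 : ℝ) ≤ ENNReal.ofReal (∫ y, u y) := by
      rw [ofReal_integral_eq_lintegral_ofReal hui (Filter.Eventually.of_forall fun y => (hu y).1)]
      refine lintegral_mono fun y => ?_
      rw [ENNReal.ofReal_rpow_of_nonneg (hu y).1 (by norm_num)]
      refine ENNReal.ofReal_le_ofReal ?_
      rw [Real.rpow_two]
      nlinarith [(hu y).1, (hu y).2]
    have e3 := ENNReal.lintegral_mul_le_Lp_mul_Lq (volume : Measure E2)
      (p := 2) (q := 2) (by constructor <;> norm_num) hF.1.enorm hum.ennreal_ofReal.aemeasurable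
    have e4 : ENNReal.ofReal A ≤ ENNReal.ofReal (M * (∫ y, u y) ^ (1 / 2 : ℝ)) := by
      rw [e1]
      refine e3.trans ?_
      rw [ENNReal.ofReal_mul hM0, ← ENNReal.ofReal_rpow_of_nonneg hU0 (by norm_num)]
      gcongr
      calc _ ≤ ((ENNReal.ofReal M) ^ (2 : ℝ)) ^ (1 / 2 : ℝ) := by gcongr
        _ = _ := by rw [← ENNReal.rpow_mul]; norm_num
    exact (ENNReal.ofReal_le_ofReal_iff (by positivity)).1 e4
  calc A = A ^ (1 - θ) * A ^ θ := by
        rw [← Real.rpow_add_of_nonneg hA0 (by linarith) h0]; simp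
    _ ≤ N ^ (1 - θ) * (M * (∫ y, u y) ^ (1 / 2 : ℝ)) ^ θ := by
        have : 0 ≤ N := hA0.trans hAN
        gcongr
    _ = _ := by
        rw [Real.mul_rpow hM0 (by positivity), ← Real.rpow_mul hU0, mul_assoc]
        congr 3; ring

lemma nrm_nonneg (g : Fin 2 → E2 → ℝ) : 0 ≤ ∑ i, ∫ y, |g i y| :=
  Finset.sum_nonneg fun _ _ => int_abs_nonneg _

lemma W1.sup1 {f : E2 → ℝ} {g : Fin 2 → E2 → ℝ} (h : W1 f g) {u : E2 → ℝ}
    (hum : Measurable u) (hu : ∀ x, u x ∈ Icc (0 : ℝ) 1) (hui : Integrable u)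
    {θ : ℝ} (h0 : 0 ≤ θ) (h1 : θ ≤ 1) (x : E2) :
    ∫ ξ, |f (x - ξ)| * u ξ ≤
      (∫ y, |f y|) ^ (1 - θ) * (∑ i, ∫ y, |g i y|) ^ θ * (∫ y, u y) ^ (θ / 2) := by
  refine interp (h.int.comp_sub_left x) (nrm_nonneg g) ?_ ?_ hum hu hui h0 h1
  · rw [lintegral_sub_left_eq_self (fun y => ‖f y‖ₑ ^ (2 : ℝ)) x]
    exact h.sob
  · rw [integral_sub_left_eq_self (fun y => |f y|) volume x]

lemma W1.diff1 {f : E2 → ℝ} {g : Fin 2 → E2 → ℝ} (h : W1 f g) {u : E2 → ℝ}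
    (hum : Measurable u) (hu : ∀ x, u x ∈ Icc (0 : ℝ) 1) (hui : Integrable u)
    {θ : ℝ} (h0 : 0 ≤ θ) (h1 : θ ≤ 1) (x₁ x₂ : E2) :
    ∫ ξ, |f (x₁ - ξ) - f (x₂ - ξ)| * u ξ ≤
      2 * (∑ i, ∫ y, |g i y|) * ‖x₁ - x₂‖ ^ (1 - θ) * (∫ y, u y) ^ (θ / 2) := by
  set M := ∑ i, ∫ y, |g i y| with hM
  have hM0 : 0 ≤ M := nrm_nonneg g
  have hU0 : 0 ≤ ∫ y, u y := integral_nonneg fun y => (hu y).1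
  have key := interp (F := fun ξ => f (x₁ - ξ) - f (x₂ - ξ)) (M := 2 * M) (N := ‖x₁ - x₂‖ * M)
    ((h.int.comp_sub_left x₁).sub (h.int.comp_sub_left x₂)) (by positivity) ?_ ?_ hum hu hui h0 h1
  · refine key.trans (mul_le_mul_of_nonneg_right ?_ (by positivity))
    rw [Real.mul_rpow (norm_nonneg _) hM0, Real.mul_rpow (by norm_num) hM0]
    have e1 : M ^ (1 - θ) * M ^ θ = M := by
      rw [← Real.rpow_add_of_nonneg hM0 (by linarith) h0]; simp
    have e2 : (2 : ℝ) ^ θ ≤ 2 := by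
      calc (2 : ℝ) ^ θ ≤ 2 ^ (1 : ℝ) := Real.rpow_le_rpow_of_exponent_le (by norm_num) h1
        _ = 2 := by simp
    calc _ = 2 ^ θ * (M ^ (1 - θ) * M ^ θ) * ‖x₁ - x₂‖ ^ (1 - θ) := by ring
      _ ≤ _ := by rw [e1]; gcongr
  · have hs := h.sob
    rw [← hM] at hs
    have hx : ∀ x : E2, ∫⁻ ξ, ‖f (x - ξ)‖ₑ ^ (2 : ℝ) ≤ (ENNReal.ofReal M) ^ (2 : ℝ) := fun x => by
      rw [lintegral_sub_left_eq_self (fun y => ‖f y‖ₑ ^ (2 : ℝ)) x]; exact hs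
    have hm : ∀ x : E2, AEMeasurable (fun ξ => ‖f (x - ξ)‖ₑ ^ (2 : ℝ)) := fun x =>
      (h.int.comp_sub_left x).1.enorm.pow_const _
    calc ∫⁻ ξ, ‖f (x₁ - ξ) - f (x₂ - ξ)‖ₑ ^ (2 : ℝ)
        ≤ ∫⁻ ξ, 2 * (‖f (x₁ - ξ)‖ₑ ^ (2 : ℝ) + ‖f (x₂ - ξ)‖ₑ ^ (2 : ℝ)) := by
          refine lintegral_mono fun ξ => ?_
          calc _ ≤ (‖f (x₁ - ξ)‖ₑ + ‖f (x₂ - ξ)‖ₑ) ^ (2 : ℝ) := by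
                gcongr; exact enorm_sub_le
            _ ≤ _ := by
                have := ENNReal.rpow_add_le_mul_rpow_add_rpow ‖f (x₁ - ξ)‖ₑ ‖f (x₂ - ξ)‖ₑ
                  (p := 2) (by norm_num)
                norm_num at this ⊢
                exact this
      _ = 2 * ((∫⁻ ξ, ‖f (x₁ - ξ)‖ₑ ^ (2 : ℝ)) + ∫⁻ ξ, ‖f (x₂ - ξ)‖ₑ ^ (2 : ℝ)) := by
          rw [lintegral_const_mul' _ _ (by norm_num), lintegral_add_left' (hm x₁)]
      _ ≤ 2 * ((ENNReal.ofReal M) ^ (2 : ℝ) + (ENNReal.ofReal M) ^ (2 : ℝ)) := by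
          gcongr <;> exact hx _
      _ = _ := by
          rw [ENNReal.ofReal_mul (by norm_num), ENNReal.mul_rpow_of_nonneg _ _ (by norm_num)]
          norm_num
          ring
  · have := h.transl (x₁ - x₂)
    rw [← integral_sub_left_eq_self (fun y => |f (y + (x₁ - x₂)) - f y|) volume x₂] at this
    convert this using 6
    abel

/-- Bilinear form with kernel `m`. -/
def Tm (m : E2 × E2 → ℝ) (a b : E2 → ℝ) : ℝ :=
  ∫ z : E2 × E2, a z.1 * b z.2 * m z ∂((volume : Measure E2).prod volume)

/-- Kernel assumptions. -/
structure Ker (m : E2 × E2 → ℝ) (u : E2 → ℝ) (c : ℝ) : Prop where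
  meas : Measurable m
  c0 : 0 ≤ c
  um : Measurable u
  u01 : ∀ x, u x ∈ Icc (0 : ℝ) 1
  bd : ∀ z, |m z| ≤ c * (u z.1 * u z.2)

lemma Ker.int {m : E2 × E2 → ℝ} {u : E2 → ℝ} {c : ℝ} (K : Ker m u c) {a b : E2 → ℝ}
    (ha : Integrable a) (hb : Integrable b) :
    Integrable (fun z : E2 × E2 => a z.1 * b z.2 * m z) ((volume : Measure E2).prod volume) := by
  refine (ha.mul_prod hb).mul_bdd (c := c) K.meas.aestronglyMeasurable
    (Filter.Eventually.of_forall fun z => ?_)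
  refine (K.bd z).trans (mul_le_of_le_one_right K.c0 ?_)
  exact mul_le_one₀ (K.u01 _).2 (K.u01 _).1 (K.u01 _).2

lemma Ker.bound {m : E2 × E2 → ℝ} {u : E2 → ℝ} {c : ℝ} (K : Ker m u c) {a b : E2 → ℝ}
    (ha : Integrable a) (hb : Integrable b) :
    |Tm m a b| ≤ c * ((∫ y, |a y| * u y) * ∫ y, |b y| * u y) := by
  have h1 : Integrable (fun z : E2 × E2 => (|a z.1| * u z.1) * (|b z.2| * u z.2))
      ((volume : Measure E2).prod volume) :=
    (mul_u_int ha K.um K.u01).mul_prod (mul_u_int hb K.um K.u01)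
  rw [← integral_prod_mul, ← integral_const_mul]
  refine (abs_integral_le_integral_abs).trans ?_
  refine integral_mono (K.int ha hb).abs (h1.const_mul c) fun z => ?_
  simp only [abs_mul]
  calc _ ≤ |a z.1| * |b z.2| * (c * (u z.1 * u z.2)) := by gcongr; exact K.bd z
    _ = _ := by ring

lemma Ker.sub_left {m : E2 × E2 → ℝ} {u : E2 → ℝ} {c : ℝ} (K : Ker m u c) {a a' b : E2 → ℝ}
    (ha : Integrable a) (ha' : Integrable a') (hb : Integrable b) :
    Tm m (fun y => a y - a' y) b = Tm m a b - Tm m a' b := by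
  unfold Tm
  rw [← integral_sub (K.int ha hb) (K.int ha' hb)]
  congr 1; ext z; ring

lemma Ker.sub_right {m : E2 × E2 → ℝ} {u : E2 → ℝ} {c : ℝ} (K : Ker m u c) {a b b' : E2 → ℝ}
    (ha : Integrable a) (hb : Integrable b) (hb' : Integrable b') :
    Tm m a (fun y => b y - b' y) = Tm m a b - Tm m a b' := by
  unfold Tm
  rw [← integral_sub (K.int ha hb) (K.int ha hb')]
  congr 1; ext z; ring

lemma Ker.sum_left {m : E2 × E2 → ℝ} {u : E2 → ℝ} {c : ℝ} (K : Ker m u c) {v : E2}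
    {a : Fin 2 → E2 → ℝ} {b : E2 → ℝ} (ha : ∀ i, Integrable (a i)) (hb : Integrable b) :
    Tm m (fun y => ∑ i, v i * a i y) b = ∑ i, v i * Tm m (a i) b := by
  unfold Tm
  simp_rw [← integral_const_mul]
  rw [← integral_finsetSum _ fun i _ => (K.int (ha i) hb).const_mul _]
  congr 1; ext z; rw [Finset.sum_mul, Finset.sum_mul]
  refine Finset.sum_congr rfl fun i _ => by ring

lemma Ker.sum_right {m : E2 × E2 → ℝ} {u : E2 → ℝ} {c : ℝ} (K : Ker m u c) {v : E2}
    {a : Fin 2 → E2 → ℝ} {b : E2 → ℝ} (ha : ∀ i, Integrable (a i)) (hb : Integrable b) :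
    Tm m b (fun y => ∑ i, v i * a i y) = ∑ i, v i * Tm m b (a i) := by
  unfold Tm
  simp_rw [← integral_const_mul]
  rw [← integral_finsetSum _ fun i _ => (K.int hb (ha i)).const_mul _]
  congr 1; ext z; rw [Finset.mul_sum, Finset.sum_mul]
  refine Finset.sum_congr rfl fun i _ => by ring

/-- `a` evaluated at `x - ·`. -/
def sh (a : E2 → ℝ) (x : E2) : E2 → ℝ := fun ξ => a (x - ξ)

lemma sh_int {a : E2 → ℝ} (h : Integrable a) (x : E2) : Integrable (sh a x) :=
  h.comp_sub_left x

lemma sh_abs (a : E2 → ℝ) (x : E2) : ∫ ξ, |sh a x ξ| = ∫ y, |a y| :=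
  integral_sub_left_eq_self (fun y => |a y|) volume x

/-- The bound with both factors in L¹. -/
lemma Ker.bound1 {m : E2 × E2 → ℝ} {u : E2 → ℝ} {c : ℝ} (K : Ker m u c) {a b : E2 → ℝ}
    (ha : Integrable a) (hb : Integrable b) :
    |Tm m a b| ≤ c * ((∫ y, |a y|) * ∫ y, |b y|) := by
  refine (K.bound ha hb).trans ?_
  have h1 := mul_u_le ha K.um K.u01
  have h2 := mul_u_le hb K.um K.u01
  have h3 := K.c0
  have h4 : 0 ≤ ∫ y, |b y| * u y := mul_u_nonneg K.u01
  have h5 := int_abs_nonneg a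
  gcongr

/-- Generic Hölder estimate of the bilinear form. -/
lemma Ker.holder {m : E2 × E2 → ℝ} {u : E2 → ℝ} {c : ℝ} (K : Ker m u c) {a b : E2 → ℝ}
    {a' b' : Fin 2 → E2 → ℝ} (ha : W1 a a') (hb : W1 b b') (hui : Integrable u)
    {θ : ℝ} (h0 : 0 ≤ θ) (h1 : θ ≤ 1) (x₁ x₂ : E2) :
    |Tm m (sh a x₁) (sh b x₁) - Tm m (sh a x₂) (sh b x₂)| ≤
      c * (2 * ((∑ i, ∫ y, |a' i y|) * (∫ y, |b y|) + (∑ i, ∫ y, |b' i y|) * (∫ y, |a y|))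
        * ‖x₁ - x₂‖ ^ (1 - θ) * (∫ y, u y) ^ (θ / 2)) := by
  have A1 := sh_int ha.int x₁
  have A2 := sh_int ha.int x₂
  have B1 := sh_int hb.int x₁
  have B2 := sh_int hb.int x₂
  have e : Tm m (sh a x₁) (sh b x₁) - Tm m (sh a x₂) (sh b x₂) =
      Tm m (fun y => sh a x₁ y - sh a x₂ y) (sh b x₁)
        + Tm m (sh a x₂) (fun y => sh b x₁ y - sh b x₂ y) := by
    rw [K.sub_left A1 A2 B1, K.sub_right A2 B1 B2]; ring
  rw [e]
  refine (abs_add_le _ _).trans ?_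
  have t1 := K.bound (A1.sub A2) B1
  have t2 := K.bound A2 (B1.sub B2)
  have d1 := ha.diff1 K.um K.u01 hui h0 h1 x₁ x₂
  have d2 := hb.diff1 K.um K.u01 hui h0 h1 x₁ x₂
  have n1 : ∫ y, |sh b x₁ y| * u y ≤ ∫ y, |b y| := by
    rw [← sh_abs b x₁]; exact mul_u_le B1 K.um K.u01
  have n2 : ∫ y, |sh a x₂ y| * u y ≤ ∫ y, |a y| := by
    rw [← sh_abs a x₂]; exact mul_u_le A2 K.um K.u01
  have p1 : 0 ≤ ∫ y, |sh b x₁ y| * u y := mul_u_nonneg K.u01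
  have p2 : 0 ≤ ∫ y, |sh a x₂ y| * u y := mul_u_nonneg K.u01
  have p3 : 0 ≤ ∫ ξ, |b (x₁ - ξ) - b (x₂ - ξ)| * u ξ :=
    mul_u_nonneg (F := fun ξ => b (x₁ - ξ) - b (x₂ - ξ)) K.u01
  have q1 := mul_le_mul_of_nonneg_left (mul_le_mul d1 n1 p1
    ((mul_u_nonneg (F := fun ξ => a (x₁ - ξ) - a (x₂ - ξ)) K.u01).trans d1)) K.c0
  have q2 := mul_le_mul_of_nonneg_left (mul_le_mul n2 d2 p3 (int_abs_nonneg a)) K.c0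
  refine (add_le_add (t1.trans q1) (t2.trans q2)).trans (le_of_eq ?_)
  ring

/-- Differential of `x ↦ T(a(x-·), a(x-·))`. -/
def dT (m : E2 × E2 → ℝ) (a : E2 → ℝ) (a' : Fin 2 → E2 → ℝ) (x : E2) : E2 →L[ℝ] ℝ :=
  ∑ i, (Tm m (sh (a' i) x) (sh a x) + Tm m (sh a x) (sh (a' i) x)) •
    (EuclideanSpace.proj i : E2 →L[ℝ] ℝ)

lemma Ker.hasFDerivAt {m : E2 × E2 → ℝ} {u : E2 → ℝ} {c : ℝ} (K : Ker m u c) {a : E2 → ℝ}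
    {a' : Fin 2 → E2 → ℝ} {a'' : Fin 2 → Fin 2 → E2 → ℝ} (ha : W1 a a')
    (ha' : ∀ i, W1 (a' i) (a'' i)) (x : E2) :
    HasFDerivAt (fun x => Tm m (sh a x) (sh a x)) (dT m a a' x) x := by
  set N0 := ∫ y, |a y| with hN0
  set N1 := ∑ i, ∫ y, |a' i y| with hN1
  set N2 := ∑ i, ∑ j, ∫ y, |a'' i j y| with hN2
  set D : ℝ := c * (N1 * N1 + 2 * (N2 * N0)) with hD
  have main : ∀ h : E2, ‖Tm m (sh a (x + h)) (sh a (x + h)) - Tm m (sh a x) (sh a x)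
      - dT m a a' x h‖ ≤ D * ‖h‖ ^ 2 := by
    intro h
    have A := sh_int ha.int (x + h)
    have B := sh_int ha.int x
    have Li : ∀ i, Integrable (sh (a' i) x) := fun i => sh_int (ha.dint i) x
    have L : Integrable (fun y => ∑ i, h i * sh (a' i) x y) := dir_int Li
    have AB : Integrable (fun y => sh a (x + h) y - sh a x y) := A.sub B
    have Rr : Integrable (fun y => (sh a (x + h) y - sh a x y) - ∑ i, h i * sh (a' i) x y) :=
      AB.sub L
    have e : Tm m (sh a (x + h)) (sh a (x + h)) - Tm m (sh a x) (sh a x) - dT m a a' x h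
        = Tm m (fun y => sh a (x + h) y - sh a x y) (fun y => sh a (x + h) y - sh a x y)
        + Tm m (fun y => (sh a (x + h) y - sh a x y) - ∑ i, h i * sh (a' i) x y) (sh a x)
        + Tm m (sh a x) (fun y => (sh a (x + h) y - sh a x y) - ∑ i, h i * sh (a' i) x y) := by
      have e1 : dT m a a' x h = ∑ i, h i * Tm m (sh (a' i) x) (sh a x)
          + ∑ i, h i * Tm m (sh a x) (sh (a' i) x) := by
        simp [dT, add_mul, mul_comm]
        ring
      rw [e1, K.sub_left AB L B, K.sub_right B AB L, K.sum_left Li B, K.sum_right Li B,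
        K.sub_left A B AB, K.sub_right A A B, K.sub_right B A B, K.sub_left A B B]
      ring
    have hh : ∫ y, |sh a (x + h) y - sh a x y| ≤ ‖h‖ * N1 := by
      have := ha.transl h
      rw [← integral_sub_left_eq_self (fun y => |a (y + h) - a y|) volume x] at this
      have hx : ∀ y, x + h - y = x - y + h := fun y => by abel
      simp only [sh, hx]
      exact this
    have hr : ∫ y, |(sh a (x + h) y - sh a x y) - ∑ i, h i * sh (a' i) x y| ≤ ‖h‖ ^ 2 * N2 := by
      have := ha.remainder ha' h
      rw [← integral_sub_left_eq_self
        (fun y => |a (y + h) - a y - ∑ i, h i * a' i y|) volume x] at this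
      have hx : ∀ y, x + h - y = x - y + h := fun y => by abel
      simp only [sh, hx]
      exact this
    have hb : ∫ y, |sh a x y| = N0 := sh_abs a x
    have b1 := K.bound1 AB AB
    have b2 := K.bound1 Rr B
    have b3 := K.bound1 B Rr
    rw [hb] at b2 b3
    have c1 := mul_le_mul_of_nonneg_left (mul_le_mul hh hh (int_abs_nonneg _)
      ((int_abs_nonneg _).trans hh)) K.c0
    have c2 := mul_le_mul_of_nonneg_left (mul_le_mul_of_nonneg_right hr (int_abs_nonneg a)) K.c0
    have c3 := mul_le_mul_of_nonneg_left (mul_le_mul_of_nonneg_left hr (int_abs_nonneg a)) K.c0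
    rw [e, Real.norm_eq_abs]
    refine (abs_add_le _ _).trans ?_
    refine (add_le_add (abs_add_le _ _) le_rfl).trans ?_
    refine (add_le_add (add_le_add (b1.trans c1) (b2.trans c2)) (b3.trans c3)).trans (le_of_eq ?_)
    rw [hD]; ring
  rw [hasFDerivAt_iff_isLittleO_nhds_zero]
  refine Asymptotics.IsBigO.trans_isLittleO (g := fun h : E2 => ‖h‖ ^ 2) ?_ ?_
  · refine Asymptotics.IsBigO.of_bound D (Filter.Eventually.of_forall fun h => ?_)
    refine (main h).trans (le_of_eq ?_)
    rw [norm_pow, norm_norm]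
  · exact Asymptotics.isLittleO_norm_pow_id one_lt_two

lemma sum_proj_norm (w : Fin 2 → ℝ) :
    ‖∑ i, w i • (EuclideanSpace.proj i : E2 →L[ℝ] ℝ)‖ ≤ ∑ i, |w i| := by
  refine (norm_sum_le _ _).trans (Finset.sum_le_sum fun i _ => ?_)
  rw [norm_smul, Real.norm_eq_abs]
  refine mul_le_of_le_one_right (abs_nonneg _) ?_
  refine ContinuousLinearMap.opNorm_le_bound _ zero_le_one fun v => ?_
  simpa using coord_le v i

lemma resc_int {f : E2 → ℝ} (hf : Integrable f) {s : ℝ} (hs : 0 < s) : Integrable (resc s f) :=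
  (hf.comp_smul (inv_ne_zero hs.ne')).const_mul _

lemma resc_integral (f : E2 → ℝ) {s : ℝ} (hs : 0 < s) : ∫ x, resc s f x = ∫ x, f x := by
  unfold resc
  rw [integral_const_mul, Measure.integral_comp_smul]
  simp only [finrank_euclideanSpace, Fintype.card_fin, smul_eq_mul]
  rw [abs_of_pos (by positivity), ← mul_assoc]
  have : s ≠ 0 := hs.ne'
  field_simp

lemma resc_abs (f : E2 → ℝ) {s : ℝ} (hs : 0 < s) : ∫ x, |resc s f x| = ∫ x, |f x| := by
  rw [← resc_integral (fun x => |f x|) hs]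
  congr 1; ext x
  simp only [resc, abs_mul]
  rw [abs_of_pos (by positivity : 0 < s⁻¹ ^ 2)]

lemma W1.resc {f : E2 → ℝ} {g : Fin 2 → E2 → ℝ} (h : W1 f g) {s : ℝ} (hs : 0 < s) :
    W1 (resc s f) (fun i x => s⁻¹ * resc s (g i) x) := by
  refine ⟨resc_int h.int hs, fun i => (resc_int (h.dint i) hs).const_mul _, fun i φ h1 h2 => ?_⟩
  have hφ1 : ContDiff ℝ 1 φ := h1.of_le (by exact_mod_cast le_top)
  have hs' : s ≠ 0 := hs.ne'
  have key := h.wd i (fun x => φ (s • x)) (h1.comp (contDiff_const_smul s))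
    (h2.comp_homeomorph (Homeomorph.smulOfNeZero s hs'))
  have hfd : ∀ x, fderiv ℝ (fun x => φ (s • x)) x = s • fderiv ℝ φ (s • x) := by
    intro x
    exact fderiv_comp_smul s
  simp only [hfd] at key
  have e1 : ∫ x, _root_.resc s f x * fderiv ℝ φ x (EuclideanSpace.single i 1)
      = ∫ x, f x * fderiv ℝ φ (s • x) (EuclideanSpace.single i 1) := by
    rw [← resc_integral (fun x => f x * fderiv ℝ φ (s • x) (EuclideanSpace.single i 1)) hs]
    congr 1; ext x
    simp only [_root_.resc, smul_inv_smul₀ hs']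
    ring
  have e2 : ∫ x, _root_.resc s (g i) x * φ x = ∫ x, g i x * φ (s • x) := by
    rw [← resc_integral (fun x => g i x * φ (s • x)) hs]
    congr 1; ext x
    simp only [_root_.resc, smul_inv_smul₀ hs']
    ring
  rw [e1]
  simp_rw [mul_assoc s⁻¹]
  rw [integral_const_mul, e2]
  have e3 : ∫ x, f x * (s • fderiv ℝ φ (s • x)) (EuclideanSpace.single i 1)
      = s * ∫ x, f x * fderiv ℝ φ (s • x) (EuclideanSpace.single i 1) := by
    rw [← integral_const_mul]; congr 1; ext x
    simp; ring
  rw [e3] at key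
  rw [← mul_neg, ← key]
  field_simp

lemma W1.smul {f : E2 → ℝ} {g : Fin 2 → E2 → ℝ} (h : W1 f g) (r : ℝ) :
    W1 (fun x => r * f x) (fun i x => r * g i x) := by
  refine ⟨h.int.const_mul _, fun i => (h.dint i).const_mul _, fun i φ h1 h2 => ?_⟩
  simp_rw [mul_assoc r]
  rw [integral_const_mul, integral_const_mul, h.wd i φ h1 h2, mul_neg]

lemma W1.add {f f' : E2 → ℝ} {g g' : Fin 2 → E2 → ℝ} (h : W1 f g) (h' : W1 f' g') :
    W1 (fun x => f x + f' x) (fun i x => g i x + g' i x) := by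
  refine ⟨h.int.add h'.int, fun i => (h.dint i).add (h'.dint i), fun i φ h1 h2 => ?_⟩
  have hφ1 : ContDiff ℝ 1 φ := h1.of_le (by exact_mod_cast le_top)
  have hdc : ∀ w : E2, Continuous (fun x => fderiv ℝ φ x w) := fun w =>
    (hφ1.continuous_fderiv one_ne_zero).clm_apply continuous_const
  simp_rw [add_mul]
  rw [integral_add (test_int h.int (hdc _) (h2.fderiv_apply (𝕜 := ℝ) _))
      (test_int h'.int (hdc _) (h2.fderiv_apply (𝕜 := ℝ) _)),
    integral_add (test_int (h.dint i) h1.continuous h2) (test_int (h'.dint i) h1.continuous h2),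
    h.wd i φ h1 h2, h'.wd i φ h1 h2]
  ring

lemma W1.of_smooth {f : E2 → ℝ} (hd : Differentiable ℝ f) (hf : Integrable f)
    (hi : ∀ i, Integrable (fun x => fderiv ℝ f x (EuclideanSpace.single i 1))) :
    W1 f (fun i x => fderiv ℝ f x (EuclideanSpace.single i 1)) := by
  refine ⟨hf, hi, fun i φ h1 h2 => ?_⟩
  have hφ1 : ContDiff ℝ 1 φ := h1.of_le (by exact_mod_cast le_top)
  have hdc : ∀ w : E2, Continuous (fun x => fderiv ℝ φ x w) := fun w =>
    (hφ1.continuous_fderiv one_ne_zero).clm_apply continuous_const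
  exact integral_mul_fderiv_eq_neg_fderiv_mul_of_integrable
    (test_int (hi i) h1.continuous h2) (test_int hf (hdc _) (h2.fderiv_apply (𝕜 := ℝ) _))
    (test_int hf h1.continuous h2) (fun x _ => hd x) (fun x _ => hφ1.differentiable one_ne_zero x)

lemma gauss_contDiff : ContDiff ℝ (⊤ : ℕ∞) Gauss := by
  unfold Gauss
  exact contDiff_const.mul (((contDiff_norm_sq ℝ).neg.div_const 2).exp)

lemma gauss_hasFDerivAt (x : E2) : HasFDerivAt Gauss ((-Gauss x) • innerSL ℝ x) x := by
  have h1 : HasFDerivAt (fun x : E2 => ‖x‖ ^ 2) (2 • innerSL ℝ x) x :=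
    (hasStrictFDerivAt_norm_sq x).hasFDerivAt
  have h2 := (((h1.neg).mul_const (2⁻¹ : ℝ)).exp).const_mul ((2 * Real.pi)⁻¹)
  have h3 : HasFDerivAt Gauss _ x := h2.congr_of_eventuallyEq
    (Filter.Eventually.of_forall fun y => by simp [Gauss, div_eq_mul_inv])
  refine h3.congr_fderiv ?_
  ext v
  simp [Gauss, div_eq_mul_inv]
  ring

lemma inner_e (x : E2) (i : Fin 2) : inner ℝ x (EuclideanSpace.single i (1 : ℝ)) = x i := by
  rw [EuclideanSpace.inner_single_right]; simp

lemma gaussD_eq (i : Fin 2) (x : E2) : GaussD i x = -(x i * Gauss x) := by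
  rw [GaussD, (gauss_hasFDerivAt x).fderiv]
  simp [mul_comm, inner_e]

lemma gaussD_hasFDerivAt (i : Fin 2) (x : E2) : HasFDerivAt (GaussD i)
    (-(x i • ((-Gauss x) • innerSL ℝ x) + Gauss x • (EuclideanSpace.proj i : E2 →L[ℝ] ℝ))) x := by
  have h1 : HasFDerivAt (fun x : E2 => x i) (EuclideanSpace.proj i : E2 →L[ℝ] ℝ) x :=
    (EuclideanSpace.proj i : E2 →L[ℝ] ℝ).hasFDerivAt
  have h2 := (h1.mul (gauss_hasFDerivAt x)).neg
  exact h2.congr_of_eventuallyEq (Filter.Eventually.of_forall fun y => by simp [gaussD_eq])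

lemma gaussD2_abs (i j : Fin 2) (x : E2) : |GaussD2 i j x| ≤ (‖x‖ ^ 2 + 1) * Gauss x := by
  have hG : 0 ≤ Gauss x := by unfold Gauss; positivity
  have e : GaussD2 i j x
      = (x i * x j - (if i = j then 1 else 0)) * Gauss x := by
    rw [GaussD2, (gaussD_hasFDerivAt i x).fderiv]
    simp [inner_e]
    split_ifs <;> ring
  rw [e, abs_mul, abs_of_nonneg hG]
  refine mul_le_mul_of_nonneg_right ?_ hG
  refine (abs_sub _ _).trans ?_
  refine add_le_add ?_ ?_
  · rw [abs_mul, sq]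
    exact mul_le_mul (coord_le x i) (coord_le x j) (abs_nonneg _) (norm_nonneg _)
  · split_ifs <;> simp

lemma gauss_dom_int : Integrable (fun x : E2 => Real.exp (-‖x‖ ^ 2 / 4)) := by
  have h := GaussianFourier.integrable_cexp_neg_mul_sq_norm_add_of_euclideanSpace
    (ι := Fin 2) (b := (1 / 4 : ℝ)) (by simp) 0 0
  refine h.norm.congr (Filter.Eventually.of_forall fun x => ?_)
  simp only [Complex.norm_exp]
  congr 1
  rw [← Complex.ofReal_pow]
  simp [-Complex.ofReal_pow]
  ring

lemma gauss_dom (x : E2) : (‖x‖ ^ 2 + 1) * Gauss x ≤ 5 * Real.exp (-‖x‖ ^ 2 / 4) := by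
  have h1 : Gauss x ≤ Real.exp (-‖x‖ ^ 2 / 2) := by
    unfold Gauss
    refine mul_le_of_le_one_left (Real.exp_pos _).le ?_
    refine inv_le_one_of_one_le₀ ?_
    linarith [Real.pi_gt_three]
  have h2 : ‖x‖ ^ 2 + 1 ≤ 5 * Real.exp (‖x‖ ^ 2 / 4) := by
    have := Real.add_one_le_exp (‖x‖ ^ 2 / 4)
    nlinarith [sq_nonneg ‖x‖]
  calc _ ≤ (5 * Real.exp (‖x‖ ^ 2 / 4)) * Real.exp (-‖x‖ ^ 2 / 2) :=
        mul_le_mul h2 h1 (by unfold Gauss; positivity) (by positivity)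
    _ = _ := by
        rw [mul_assoc, ← Real.exp_add]; congr 2; ring

lemma int_of_dom {F : E2 → ℝ} (hF : Continuous F) (h : ∀ x, |F x| ≤ (‖x‖ ^ 2 + 1) * Gauss x) :
    Integrable F :=
  (gauss_dom_int.const_mul 5).mono' hF.aestronglyMeasurable
    (Filter.Eventually.of_forall fun x => (h x).trans (gauss_dom x))

lemma gaussD_contDiff (i : Fin 2) : ContDiff ℝ (⊤ : ℕ∞) (GaussD i) := by
  have : GaussD i = fun x => -(x i * Gauss x) := funext (gaussD_eq i)
  rw [this]
  exact (((EuclideanSpace.proj i : E2 →L[ℝ] ℝ).contDiff).mul gauss_contDiff).neg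

lemma gauss_int : Integrable Gauss := by
  refine int_of_dom gauss_contDiff.continuous fun x => ?_
  have hG : 0 ≤ Gauss x := by unfold Gauss; positivity
  rw [abs_of_nonneg hG]
  nlinarith [sq_nonneg ‖x‖]

lemma gaussD_int (i : Fin 2) : Integrable (GaussD i) := by
  refine int_of_dom (gaussD_contDiff i).continuous fun x => ?_
  have hG : 0 ≤ Gauss x := by unfold Gauss; positivity
  rw [gaussD_eq, abs_neg, abs_mul, abs_of_nonneg hG]
  refine mul_le_mul_of_nonneg_right ((coord_le x i).trans ?_) hG
  nlinarith [sq_nonneg (‖x‖ - 1)]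

lemma gaussD2_int (i j : Fin 2) : Integrable (GaussD2 i j) := by
  refine int_of_dom ?_ (gaussD2_abs i j)
  exact (((gaussD_contDiff i).of_le (m := 1) (by exact_mod_cast le_top)).continuous_fderiv
    one_ne_zero).clm_apply continuous_const

lemma gauss_W1 : W1 Gauss GaussD :=
  W1.of_smooth (gauss_contDiff.differentiable (by simp)) gauss_int gaussD_int

lemma gaussD_W1 (i : Fin 2) : W1 (GaussD i) (GaussD2 i) :=
  W1.of_smooth ((gaussD_contDiff i).differentiable (by simp)) (gaussD_int i) (gaussD2_int i)

lemma abs_const_int (r : ℝ) (hr : 0 ≤ r) (f : E2 → ℝ) :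
    ∫ y, |r * f y| = r * ∫ y, |f y| := by
  rw [← integral_const_mul]; congr 1; ext y; rw [abs_mul, abs_of_nonneg hr]

lemma u_integrable {u : E2 → ℝ} {R : ℝ} (hum : Measurable u) (hu : ∀ x, u x ∈ Icc (0 : ℝ) 1)
    (hs : ∀ x, x ∉ ball (0 : E2) R → u x = 0) : Integrable u := by
  have h : Integrable ((ball (0 : E2) R).indicator (fun _ => (1 : ℝ))) :=
    (integrable_indicator_iff measurableSet_ball).2 (integrableOn_const measure_ball_lt_top.ne)
  refine h.mono' hum.aestronglyMeasurable (Filter.Eventually.of_forall fun x => ?_)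
  by_cases hx : x ∈ ball (0 : E2) R
  · rw [indicator_of_mem hx, Real.norm_eq_abs, abs_of_nonneg (hu x).1]; exact (hu x).2
  · rw [indicator_of_notMem hx, hs x hx]; simp

/-- The kernel of the operator. -/
def mker (J u : E2 → ℝ) (z : E2 × E2) : ℝ := u z.1 * J (z.1 - z.2) * u z.2

lemma mker_ker {J u : E2 → ℝ} {R ε : ℝ} (hR : 0 < R) (hJ : Continuous J)
    (hε : ∀ x ∈ ball (0 : E2) (2 * R), |J x - 1| ≤ ε)
    (hum : Measurable u) (hu : ∀ x, u x ∈ Icc (0 : ℝ) 1)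
    (hs : ∀ x, x ∉ ball (0 : E2) R → u x = 0) : Ker (mker J u) u (1 + ε) := by
  have hε0 : 0 ≤ ε := (abs_nonneg _).trans (hε 0 (by simp [hR]))
  refine ⟨?_, by linarith, hum, hu, fun z => ?_⟩
  · unfold mker
    have := hJ.measurable
    fun_prop
  · unfold mker
    by_cases h1 : z.1 ∈ ball (0 : E2) R
    · by_cases h2 : z.2 ∈ ball (0 : E2) R
      · have h3 : z.1 - z.2 ∈ ball (0 : E2) (2 * R) := by
          simp only [mem_ball, dist_zero_right] at h1 h2 ⊢
          linarith [norm_sub_le z.1 z.2]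
        have h4 : |J (z.1 - z.2)| ≤ 1 + ε := by
          have := hε _ h3
          rw [abs_le] at this ⊢
          constructor <;> linarith [this.1, this.2]
        rw [abs_mul, abs_mul, abs_of_nonneg (hu z.1).1, abs_of_nonneg (hu z.2).1]
        have := (hu z.1).1
        have := (hu z.2).1
        calc u z.1 * |J (z.1 - z.2)| * u z.2 ≤ u z.1 * (1 + ε) * u z.2 := by gcongr
          _ = _ := by ring
      · simp [hs _ h2]
    · simp [hs _ h1]

lemma pop_eq {J u a : E2 → ℝ} {c : ℝ} (K : Ker (mker J u) u c) (ha : Integrable a) (x : E2) :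
    Pop a J u x = Tm (mker J u) (sh a x) (sh a x) := by
  unfold Tm
  rw [integral_prod _ (K.int (sh_int ha x) (sh_int ha x))]
  unfold Pop
  congr 1; ext ξ; congr 1; ext η
  simp only [mker, sh]; ring

lemma rpow_split {A B S t θ : ℝ} (hA : 0 ≤ A) (hB : 0 ≤ B) (hAS : A ≤ S) (hBS : B ≤ S)
    (ht : t = 1 - θ) (h0 : 0 ≤ θ) (h1 : θ ≤ 1) : A ^ t * B ^ θ ≤ S := by
  have hS : 0 ≤ S := hA.trans hAS
  have ht0 : 0 ≤ t := by linarith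
  calc A ^ t * B ^ θ ≤ S ^ t * S ^ θ := by gcongr
    _ = S := by rw [← Real.rpow_add_of_nonneg hS ht0 h0, ht]; simp


/-- `C^{0,α}`-type estimates for `𝒫_{J,s}(u)` and its gradient, with constant depending on
`p` only: with `G̃ = G + ψ`, `ψ ∈ W^{2,1}(ℝ²)`, `ε = ‖J - 1‖_{L^∞(B_{2R})}`,
`‖𝒫_{J,s}(u)‖_{C^{0,α}} ≤ ((1+ε)C/s) ‖G̃‖²_{W^{1,1}} ‖u‖_{L¹(B_R)}^{2/p}` and
`‖∇𝒫_{J,s}(u)‖_{C^{0,α}} ≤ ((1+ε)C/s²) ‖G̃‖²_{W^{2,1}} ‖u‖_{L¹(B_R)}^{2/p}`. -/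
theorem stmt16 (p : ℝ) (hp : 4 < p) (α : ℝ) (hα : α = 1 - 4 / p) :
    ∃ C : ℝ, 0 < C ∧
      ∀ (R : ℝ), 0 < R →
      ∀ (ψ : E2 → ℝ) (ψ' : Fin 2 → E2 → ℝ) (ψ'' : Fin 2 → Fin 2 → E2 → ℝ),
        Integrable ψ →
        (∀ i, IsWeakPartialDeriv i ψ (ψ' i) ∧ Integrable (ψ' i)) →
        (∀ i j, IsWeakPartialDeriv j (ψ' i) (ψ'' i j) ∧ Integrable (ψ'' i j)) →
      ∀ (J : E2 → ℝ), Continuous J →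
      ∀ (s : ℝ), 0 < s → s ≤ 1 →
      ∀ (ε : ℝ), (∀ x ∈ ball (0 : E2) (2 * R), |J x - 1| ≤ ε) →
      ∀ (u : E2 → ℝ), Measurable u → (∀ x, u x ∈ Icc (0 : ℝ) 1) →
        (∀ x, x ∉ ball (0 : E2) R → u x = 0) →
        (∀ x : E2, |Pop (resc s fun z => Gauss z + ψ z) J u x| ≤
          (1 + ε) * C / s *
            ((∫ y, |Gauss y + ψ y|) + ∑ i, ∫ y, |GaussD i y + ψ' i y|) ^ 2 *
            (∫ y, u y) ^ (2 / p)) ∧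
        (∀ x₁ x₂ : E2,
          |Pop (resc s fun z => Gauss z + ψ z) J u x₁ -
              Pop (resc s fun z => Gauss z + ψ z) J u x₂| ≤
            (1 + ε) * C / s *
              ((∫ y, |Gauss y + ψ y|) + ∑ i, ∫ y, |GaussD i y + ψ' i y|) ^ 2 *
              (∫ y, u y) ^ (2 / p) * ‖x₁ - x₂‖ ^ α) ∧
        Differentiable ℝ (Pop (resc s fun z => Gauss z + ψ z) J u) ∧
        (∀ x : E2, ‖fderiv ℝ (Pop (resc s fun z => Gauss z + ψ z) J u) x‖ ≤
          (1 + ε) * C / s ^ 2 *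
            ((∫ y, |Gauss y + ψ y|) + (∑ i, ∫ y, |GaussD i y + ψ' i y|) +
              ∑ i, ∑ j, ∫ y, |GaussD2 i j y + ψ'' i j y|) ^ 2 *
            (∫ y, u y) ^ (2 / p)) ∧
        (∀ x₁ x₂ : E2,
          ‖fderiv ℝ (Pop (resc s fun z => Gauss z + ψ z) J u) x₁ -
              fderiv ℝ (Pop (resc s fun z => Gauss z + ψ z) J u) x₂‖ ≤
            (1 + ε) * C / s ^ 2 *
              ((∫ y, |Gauss y + ψ y|) + (∑ i, ∫ y, |GaussD i y + ψ' i y|) +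
                ∑ i, ∑ j, ∫ y, |GaussD2 i j y + ψ'' i j y|) ^ 2 *
              (∫ y, u y) ^ (2 / p) * ‖x₁ - x₂‖ ^ α) := by

  have hp0 : 0 < p := by linarith
  refine ⟨4, by norm_num, ?_⟩
  intro R hR ψ ψ' ψ'' hψ hψ' hψ'' J hJ s hs hs1 ε hε u hum hu husupp
  have K := mker_ker hR hJ hε hum hu husupp
  have hui := u_integrable hum hu husupp
  have hc0 : 0 ≤ 1 + ε := K.c0
  have hWψ : W1 ψ ψ' := ⟨hψ, fun i => (hψ' i).2, fun i => (hψ' i).1⟩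
  have hWψ' : ∀ i, W1 (ψ' i) (ψ'' i) := fun i =>
    ⟨(hψ' i).2, fun j => (hψ'' i j).2, fun j => (hψ'' i j).1⟩
  have hWa := gauss_W1.add hWψ
  have hWa' := fun i => (gaussD_W1 i).add (hWψ' i)
  set N0 := ∫ y, |Gauss y + ψ y| with hN0
  set N1 := ∑ i, ∫ y, |GaussD i y + ψ' i y| with hN1
  set N2 := ∑ i, ∑ j, ∫ y, |GaussD2 i j y + ψ'' i j y| with hN2
  have hWk := hWa.resc hs
  have hWk' := fun i => ((hWa' i).resc hs).smul s⁻¹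
  set k : E2 → ℝ := resc s fun z => Gauss z + ψ z with hk
  set k' : Fin 2 → E2 → ℝ := fun i x => s⁻¹ * resc s (fun z => GaussD i z + ψ' i z) x with hk'
  have hsi : 0 ≤ s⁻¹ := by positivity
  have hs1' : 1 ≤ s⁻¹ := (one_le_inv₀ hs).2 hs1
  have hP : Pop k J u = fun x => Tm (mker J u) (sh k x) (sh k x) :=
    funext fun x => pop_eq K hWk.int x
  have n0 : ∫ y, |k y| = N0 := resc_abs _ hs
  have n1i : ∀ i, ∫ y, |k' i y| = s⁻¹ * ∫ y, |GaussD i y + ψ' i y| := fun i => by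
    simp only [hk']
    rw [abs_const_int _ hsi, resc_abs _ hs]
  have n1 : ∑ i, ∫ y, |k' i y| = s⁻¹ * N1 := by
    simp_rw [n1i, ← Finset.mul_sum]; rfl
  have n2i : ∀ i, ∑ j, ∫ y, |s⁻¹ * (s⁻¹ * resc s (fun z => GaussD2 i j z + ψ'' i j z) y)|
      = s⁻¹ * (s⁻¹ * ∑ j, ∫ y, |GaussD2 i j y + ψ'' i j y|) := fun i => by
    rw [Finset.mul_sum, Finset.mul_sum]
    refine Finset.sum_congr rfl fun j _ => ?_
    rw [abs_const_int _ hsi, abs_const_int _ hsi, resc_abs _ hs]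
  have p0 : 0 ≤ N0 := int_abs_nonneg _
  have p1 : 0 ≤ N1 := nrm_nonneg _
  have p2 : 0 ≤ N2 := Finset.sum_nonneg fun i _ => nrm_nonneg _
  set U := (∫ y, u y) ^ (2 / p) with hU
  have hU0 : 0 ≤ U := Real.rpow_nonneg (integral_nonneg fun y => (hu y).1) _
  have hθ0 : 0 ≤ 4 / p := by positivity
  have hθ1 : 4 / p ≤ 1 := by rw [div_le_one hp0]; exact hp.le
  have hθ2 : 4 / p / 2 = 2 / p := by ring
  -- sup estimate for `|k| * u`
  have hsup : ∀ x, ∫ ξ, |sh k x ξ| * u ξ ≤ s⁻¹ * (N0 + N1) * U := by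
    intro x
    have := hWk.sup1 hum hu hui hθ0 hθ1 x
    rw [hθ2] at this
    refine this.trans (mul_le_mul_of_nonneg_right ?_ hU0)
    refine rpow_split (int_abs_nonneg _) (nrm_nonneg _) ?_ ?_ rfl hθ0 hθ1
    · rw [n0]; nlinarith
    · rw [n1]; nlinarith
  have hl1 : ∀ {a : E2 → ℝ}, Integrable a → ∀ x, ∫ ξ, |sh a x ξ| * u ξ ≤ ∫ y, |a y| := by
    intro a ha x
    rw [← sh_abs a x]; exact mul_u_le (sh_int ha x) hum hu
  have hfd : ∀ x, HasFDerivAt (Pop k J u) (dT (mker J u) k k' x) x := by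
    rw [hP]
    exact fun x => K.hasFDerivAt hWk hWk' x
  have hS12 : N0 + N1 ≤ N0 + N1 + N2 := by linarith
  refine ⟨?_, ?_, fun x => (hfd x).differentiableAt, ?_, ?_⟩
  · intro x
    rw [hP]
    refine (K.bound (sh_int hWk.int x) (sh_int hWk.int x)).trans ?_
    have h1 := hl1 hWk.int x
    rw [n0] at h1
    have h2 := mul_le_mul h1 (hsup x) (mul_u_nonneg hu) p0
    refine (mul_le_mul_of_nonneg_left h2 hc0).trans ?_
    calc (1 + ε) * (N0 * (s⁻¹ * (N0 + N1) * U))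
        = ((1 + ε) * s⁻¹ * U) * (N0 * (N0 + N1)) := by ring
      _ ≤ ((1 + ε) * s⁻¹ * U) * (4 * (N0 + N1) ^ 2) := by
          refine mul_le_mul_of_nonneg_left ?_ (by positivity)
          nlinarith [mul_nonneg p0 p1]
      _ = _ := by rw [div_eq_mul_inv]; ring
  · intro x₁ x₂
    have := K.holder hWk hWk hui hθ0 hθ1 x₁ x₂
    rw [n0, n1, hθ2, ← hα] at this
    rw [hP]
    refine this.trans ?_
    calc _ = ((1 + ε) * s⁻¹ * U * ‖x₁ - x₂‖ ^ α) * (4 * (N1 * N0)) := by ring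
      _ ≤ ((1 + ε) * s⁻¹ * U * ‖x₁ - x₂‖ ^ α) * (4 * (N0 + N1) ^ 2) := by
          refine mul_le_mul_of_nonneg_left ?_ (by positivity)
          nlinarith [mul_nonneg p0 p1]
      _ = _ := by rw [div_eq_mul_inv]; ring
  · intro x
    rw [(hfd x).fderiv]
    refine (sum_proj_norm _).trans ?_
    have hi : ∀ i, |Tm (mker J u) (sh (k' i) x) (sh k x) + Tm (mker J u) (sh k x) (sh (k' i) x)|
        ≤ (1 + ε) * (2 * s⁻¹ * (s⁻¹ * (N0 + N1) * U)) * ∫ y, |GaussD i y + ψ' i y| := by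
      intro i
      have hI := hWk.dint i
      have b1 := K.bound (sh_int hI x) (sh_int hWk.int x)
      have b2 := K.bound (sh_int hWk.int x) (sh_int hI x)
      have h1 := hl1 hI x
      have h2 := mul_le_mul_of_nonneg_left
        (mul_le_mul h1 (hsup x) (mul_u_nonneg hu) (int_abs_nonneg _)) hc0
      rw [n1i] at h2
      rw [mul_comm (∫ y, |sh k x y| * u y)] at b2
      refine (abs_add_le _ _).trans ((add_le_add (b1.trans h2) (b2.trans h2)).trans (le_of_eq ?_))
      ring
    refine (Finset.sum_le_sum fun i _ => hi i).trans ?_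
    rw [← Finset.mul_sum, ← hN1]
    calc _ = ((1 + ε) * (s⁻¹) ^ 2 * U) * (2 * ((N0 + N1) * N1)) := by ring
      _ ≤ ((1 + ε) * (s⁻¹) ^ 2 * U) * (4 * (N0 + N1 + N2) ^ 2) := by
          refine mul_le_mul_of_nonneg_left ?_ (by positivity)
          nlinarith [mul_nonneg p0 p1, mul_nonneg p0 p2, mul_nonneg p1 p2]
      _ = _ := by rw [div_eq_mul_inv, inv_pow]; ring
  · intro x₁ x₂
    rw [(hfd x₁).fderiv, (hfd x₂).fderiv]
    have e : dT (mker J u) k k' x₁ - dT (mker J u) k k' x₂ =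
        ∑ i, ((Tm (mker J u) (sh (k' i) x₁) (sh k x₁) - Tm (mker J u) (sh (k' i) x₂) (sh k x₂))
          + (Tm (mker J u) (sh k x₁) (sh (k' i) x₁) - Tm (mker J u) (sh k x₂) (sh (k' i) x₂))) •
          (EuclideanSpace.proj i : E2 →L[ℝ] ℝ) := by
      unfold dT
      rw [← Finset.sum_sub_distrib]
      refine Finset.sum_congr rfl fun i _ => ?_
      ext v; simp only [ContinuousLinearMap.sub_apply, ContinuousLinearMap.smul_apply, smul_eq_mul]; ring
    rw [e]
    refine (sum_proj_norm _).trans ?_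
    have hi : ∀ i, |(Tm (mker J u) (sh (k' i) x₁) (sh k x₁)
          - Tm (mker J u) (sh (k' i) x₂) (sh k x₂))
          + (Tm (mker J u) (sh k x₁) (sh (k' i) x₁) - Tm (mker J u) (sh k x₂) (sh (k' i) x₂))|
        ≤ ((1 + ε) * (s⁻¹) ^ 2 * U * ‖x₁ - x₂‖ ^ α) * 4 *
          ((∑ j, ∫ y, |GaussD2 i j y + ψ'' i j y|) * N0
            + (∫ y, |GaussD i y + ψ' i y|) * N1) := by
      intro i
      have b1 := K.holder (hWk' i) hWk hui hθ0 hθ1 x₁ x₂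
      have b2 := K.holder hWk (hWk' i) hui hθ0 hθ1 x₁ x₂
      have n1i' : ∫ y, |s⁻¹ * resc s (fun z => GaussD i z + ψ' i z) y|
        = s⁻¹ * ∫ y, |GaussD i y + ψ' i y| := n1i i
      rw [n0, n1, n2i, n1i', hθ2, ← hα] at b1 b2
      refine (abs_add_le _ _).trans ((add_le_add b1 b2).trans (le_of_eq ?_))
      ring
    refine (Finset.sum_le_sum fun i _ => hi i).trans ?_
    rw [← Finset.mul_sum, Finset.sum_add_distrib, ← Finset.sum_mul, ← Finset.sum_mul, ← hN1, ← hN2]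
    calc _ = ((1 + ε) * (s⁻¹) ^ 2 * U * ‖x₁ - x₂‖ ^ α) * (4 * (N2 * N0 + N1 * N1)) := by ring
      _ ≤ ((1 + ε) * (s⁻¹) ^ 2 * U * ‖x₁ - x₂‖ ^ α) * (4 * (N0 + N1 + N2) ^ 2) := by
          refine mul_le_mul_of_nonneg_left ?_ (by positivity)
          nlinarith [mul_nonneg p0 p1, mul_nonneg p0 p2, mul_nonneg p1 p2]
      _ = _ := by rw [div_eq_mul_inv, inv_pow]; ring
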